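/- Let δ ∈ [0,1), p ∈ [1, ∞]. For every m×m Hermitian matrix Z and every density matrix S of rank at most r, ‖π_{S_{m,δ}}(Z) − S‖_p ≤ min( 2^{3/p+1} r^{1/p} (‖Z − S‖_∞ + 2δ) , 2 (1−δ)^{1/p} (‖Z − S‖_∞ + 2δ)^{1−1/p} ) + 2δ. -/

import Mathlib

open scoped BigOperators ENNReal
open MeasureTheory ProbabilityTheory Matrix
open scoped ComplexOrder

noncomputable section

abbrev Mat (m : ℕ) := Matrix (Fin m) (Fin m) ℂ

namespace QST

variable {m : ℕ}

/-- Hilbert–Schmidt (Frobenius) norm `‖A‖₂`. -/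
def frob (A : Mat m) : ℝ := Real.sqrt (∑ i, ∑ j, ‖A i j‖ ^ 2)

/-- Hilbert–Schmidt inner product `⟨A,B⟩ = Re tr(A B*)`. -/
def hsInner (A B : Mat m) : ℝ := (Matrix.trace (A * Bᴴ)).re

/-- Eigenvalues of a Hermitian matrix (junk value `0` otherwise). -/
def eigs (A : Mat m) : Fin m → ℝ :=
  if h : A.IsHermitian then h.eigenvalues else 0

/-- Operator (spectral) norm of a Hermitian matrix: the largest absolute value
of an eigenvalue. -/
def opNorm (A : Mat m) : ℝ := ⨆ i, |eigs A i|

/-- Schatten `p`-norm, `p ∈ [1,∞]`. -/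
def schatten (p : ℝ≥0∞) (A : Mat m) : ℝ :=
  if p = ∞ then opNorm A
  else (∑ i, |eigs A i| ^ p.toReal) ^ (1 / p.toReal)

/-- A density matrix: positive semidefinite (hence Hermitian) with unit trace. -/
def IsDensity (A : Mat m) : Prop := A.PosSemidef ∧ A.trace = 1

/-- The set `𝒮_m` of density matrices. -/
def Densities (m : ℕ) : Set (Mat m) := {A | IsDensity A}

/-- The set `𝒮_{m,δ} = {(1-δ) S + δ I/m : S ∈ 𝒮_m}`. -/
def DensitiesReg (m : ℕ) (δ : ℝ) : Set (Mat m) :=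
  {A | ∃ S, IsDensity S ∧ A = (1 - δ) • S + (δ / m) • (1 : Mat m)}

/-- `P` is the Hilbert–Schmidt projection of `Z` onto the set `C`. -/
def IsProjOn (C : Set (Mat m)) (Z P : Mat m) : Prop :=
  P ∈ C ∧ ∀ S ∈ C, frob (Z - P) ≤ frob (Z - S)

/-- Functional calculus for Hermitian matrices via the spectral decomposition
(junk value `0` for non-Hermitian matrices). -/
def hermApply (f : ℝ → ℝ) (A : Mat m) : Mat m :=
  if h : A.IsHermitian then
    (h.eigenvectorUnitary : Mat m) *
      Matrix.diagonal (fun i => (f (h.eigenvalues i) : ℂ)) *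
        (star (h.eigenvectorUnitary : Mat m))
  else 0

/-- Quantum relative entropy `K(S₁‖S₂) = tr(S₁ log S₁ - S₁ log S₂)`; the convention
`0 log 0 = 0` is automatic since `Real.log 0 = 0`. -/
def relEntropy (S₁ S₂ : Mat m) : ℝ :=
  (Matrix.trace (S₁ * hermApply Real.log S₁ - S₁ * hermApply Real.log S₂)).re

/-- Squared Bures distance `H²(S₁,S₂) = 2 - 2 tr √(√S₁ S₂ √S₁)`. -/
def bures2 (S₁ S₂ : Mat m) : ℝ :=
  2 - 2 * (Matrix.trace (hermApply Real.sqrt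
      (hermApply Real.sqrt S₁ * S₂ * hermApply Real.sqrt S₁))).re

/-- The probability simplex `Δ_m ⊂ ℝ^m`. -/
def simplex (m : ℕ) : Set (Fin m → ℝ) := {u | (∀ j, 0 ≤ u j) ∧ ∑ j, u j = 1}

/-- Euclidean norm on `ℝ^m`. -/
def e2 (x : Fin m → ℝ) : ℝ := Real.sqrt (∑ j, x j ^ 2)

/-- Supremum norm on `ℝ^m`. -/
def linf (x : Fin m → ℝ) : ℝ := ⨆ j, |x j|

/-- `v` is the Euclidean projection of `z` onto the simplex `Δ_m`. -/
def IsProjSimplex (z v : Fin m → ℝ) : Prop :=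
  v ∈ simplex m ∧ ∀ u ∈ simplex m, e2 (z - v) ≤ e2 (z - u)

/-- `E` is an orthonormal basis of the `m²`-dimensional real inner product space `ℍ_m`
of Hermitian `m×m` matrices (an orthonormal family of `m²` Hermitian matrices is
automatically a basis). -/
def IsONBasis (E : Fin (m ^ 2) → Mat m) : Prop :=
  (∀ k, (E k).IsHermitian) ∧
    ∀ k l, (Matrix.trace (E k * (E l)ᴴ)).re = if k = l then 1 else 0


/-- Real part of the `i`-th diagonal entry of `A` in the basis of columns of `U`. -/
def diagIn (U : unitaryGroup (Fin m) ℂ) (A : Mat m) (i : Fin m) : ℝ :=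
  ((star (U : Mat m) * A * (U : Mat m)) i i).re

lemma diagIn_add (U : unitaryGroup (Fin m) ℂ) (A B : Mat m) (i : Fin m) :
    diagIn U (A + B) i = diagIn U A i + diagIn U B i := by
  simp [diagIn, mul_add, add_mul]

lemma diagIn_sub (U : unitaryGroup (Fin m) ℂ) (A B : Mat m) (i : Fin m) :
    diagIn U (A - B) i = diagIn U A i - diagIn U B i := by
  simp [diagIn, mul_sub, sub_mul]

lemma diagIn_smul (U : unitaryGroup (Fin m) ℂ) (c : ℝ) (A : Mat m) (i : Fin m) :
    diagIn U (c • A) i = c * diagIn U A i := by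
  simp [diagIn]

lemma diagIn_one (U : unitaryGroup (Fin m) ℂ) (i : Fin m) : diagIn U 1 i = 1 := by
  simp [diagIn]

lemma sum_diagIn (U : unitaryGroup (Fin m) ℂ) (A : Mat m) :
    ∑ i, diagIn U A i = A.trace.re := by
  have h : (star (U : Mat m) * A * (U : Mat m)).trace = A.trace := by
    rw [trace_mul_cycle]; simp
  rw [← h]
  simp [diagIn, trace]

lemma diagIn_nonneg (U : unitaryGroup (Fin m) ℂ) {A : Mat m} (hA : A.PosSemidef) (i : Fin m) :
    0 ≤ diagIn U A i :=
  (Complex.le_def.1 (hA.conjTranspose_mul_mul_same (U : Mat m)).diag_nonneg).1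

lemma star_eigenvectorUnitary_mul_mul {A : Mat m} (hA : A.IsHermitian) :
    star (hA.eigenvectorUnitary : Mat m) * A * (hA.eigenvectorUnitary : Mat m) =
      diagonal (fun i => (hA.eigenvalues i : ℂ)) := by
  have h := hA.conjStarAlgAut_star_eigenvectorUnitary
  rw [Unitary.conjStarAlgAut_star_apply] at h
  exact h

lemma eq_eigenvectorUnitary_mul_mul {A : Mat m} (hA : A.IsHermitian) :
    A = (hA.eigenvectorUnitary : Mat m) * diagonal (fun i => (hA.eigenvalues i : ℂ)) *
      star (hA.eigenvectorUnitary : Mat m) := by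
  have h := hA.spectral_theorem
  rw [Unitary.conjStarAlgAut_apply] at h
  exact h

lemma diagIn_eigenvectorUnitary {A : Mat m} (hA : A.IsHermitian) (i : Fin m) :
    diagIn hA.eigenvectorUnitary A i = hA.eigenvalues i := by
  rw [diagIn, star_eigenvectorUnitary_mul_mul]
  simp

lemma sum_normSq_row (W : unitaryGroup (Fin m) ℂ) (i : Fin m) :
    ∑ j, Complex.normSq ((W : Mat m) i j) = 1 := by
  have h := congrFun (congrFun (Unitary.coe_mul_star_self W) i) i
  rw [Matrix.mul_apply, Matrix.one_apply_eq] at h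
  have h2 := congrArg Complex.re h
  simpa [Matrix.star_apply, Complex.normSq_apply] using h2

lemma sum_normSq_col (W : unitaryGroup (Fin m) ℂ) (j : Fin m) :
    ∑ i, Complex.normSq ((W : Mat m) i j) = 1 := by
  have h := congrFun (congrFun (Unitary.coe_star_mul_self W) j) j
  rw [Matrix.mul_apply, Matrix.one_apply_eq] at h
  have h2 := congrArg Complex.re h
  simpa [Matrix.star_apply, Complex.normSq_apply] using h2

lemma diagIn_eq_sum {A : Mat m} (hA : A.IsHermitian) (U : unitaryGroup (Fin m) ℂ) (i : Fin m) :
    diagIn U A i = ∑ j, hA.eigenvalues j *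
      Complex.normSq (((star U * hA.eigenvectorUnitary : unitaryGroup (Fin m) ℂ) : Mat m) i j) := by
  set W : unitaryGroup (Fin m) ℂ := star U * hA.eigenvectorUnitary with hW
  have h : star (U : Mat m) * A * (U : Mat m) =
      (W : Mat m) * diagonal (fun i => (hA.eigenvalues i : ℂ)) * star (W : Mat m) := by
    conv_lhs => rw [eq_eigenvectorUnitary_mul_mul hA]
    simp only [hW, Submonoid.coe_mul, Unitary.coe_star, star_mul, star_star, mul_assoc]
  rw [diagIn, h, Matrix.mul_apply]
  simp only [Matrix.mul_diagonal, Matrix.star_apply, Complex.re_sum]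
  refine Finset.sum_congr rfl fun j _ => ?_
  simp [Complex.normSq_apply]
  ring

lemma abs_diagIn_le_of_eigenvalues {A : Mat m} (hA : A.IsHermitian) {c : ℝ}
    (hc : ∀ j, |hA.eigenvalues j| ≤ c) (U : unitaryGroup (Fin m) ℂ) (i : Fin m) :
    |diagIn U A i| ≤ c := by
  rw [diagIn_eq_sum hA]
  refine (Finset.abs_sum_le_sum_abs _ _).trans ?_
  calc _ ≤ ∑ j, c * Complex.normSq
        (((star U * hA.eigenvectorUnitary : unitaryGroup (Fin m) ℂ) : Mat m) i j) := by
        refine Finset.sum_le_sum fun j _ => ?_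
        rw [abs_mul, abs_of_nonneg (Complex.normSq_nonneg _)]
        exact mul_le_mul_of_nonneg_right (hc j) (Complex.normSq_nonneg _)
    _ = c := by rw [← Finset.mul_sum, sum_normSq_row, mul_one]

lemma sum_abs_diagIn_le {A : Mat m} (hA : A.IsHermitian) (U : unitaryGroup (Fin m) ℂ) :
    ∑ i, |diagIn U A i| ≤ ∑ j, |hA.eigenvalues j| := by
  calc _ ≤ ∑ i, ∑ j, |hA.eigenvalues j| * Complex.normSq
        (((star U * hA.eigenvectorUnitary : unitaryGroup (Fin m) ℂ) : Mat m) i j) := by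
        refine Finset.sum_le_sum fun i _ => ?_
        rw [diagIn_eq_sum hA]
        refine (Finset.abs_sum_le_sum_abs _ _).trans (Finset.sum_le_sum fun j _ => ?_)
        rw [abs_mul, abs_of_nonneg (Complex.normSq_nonneg _)]
    _ = _ := by
        rw [Finset.sum_comm]
        refine Finset.sum_congr rfl fun j _ => ?_
        rw [← Finset.mul_sum, sum_normSq_col, mul_one]

lemma abs_diagIn_le_opNorm {A : Mat m} (hA : A.IsHermitian) (U : unitaryGroup (Fin m) ℂ)
    (i : Fin m) : |diagIn U A i| ≤ opNorm A := by
  refine abs_diagIn_le_of_eigenvalues hA (fun j => ?_) U i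
  have h : |eigs A j| ≤ opNorm A :=
    le_ciSup (f := fun i => |eigs A i|) (Set.finite_range _).bddAbove j
  rwa [eigs, dif_pos hA] at h

lemma opNorm_nonneg (A : Mat m) : 0 ≤ opNorm A :=
  Real.iSup_nonneg fun _ => abs_nonneg _

lemma card_neg_eigenvalues_le_rank {R T : Mat m} (hR : R.PosSemidef) (hRT : (R - T).IsHermitian) :
    (Finset.univ.filter fun j => hRT.eigenvalues j < 0).card ≤ T.rank := by
  set U := hRT.eigenvectorUnitary
  let e : {j // hRT.eigenvalues j < 0} → Fin m := Subtype.val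
  have hpd : ((star (U : Mat m) * T * (U : Mat m)).submatrix e e).PosDef := by
    have h : (star (U : Mat m) * T * (U : Mat m)).submatrix e e =
        (star (U : Mat m) * R * (U : Mat m)).submatrix e e +
          diagonal (fun j => ((-hRT.eigenvalues (e j) : ℝ) : ℂ)) := by
      have h1 : star (U : Mat m) * T * (U : Mat m) = star (U : Mat m) * R * (U : Mat m) +
          diagonal (fun j => ((-hRT.eigenvalues j : ℝ) : ℂ)) := by
        have h2 := star_eigenvectorUnitary_mul_mul hRT
        rw [mul_sub, sub_mul, sub_eq_iff_eq_add] at h2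
        rw [h2, add_comm, ← add_assoc, diagonal_add]
        simp [U]
      rw [h1]
      ext i j
      simp [diagonal_apply, e, Subtype.ext_iff]
    rw [h]
    refine PosDef.posSemidef_add ((hR.conjTranspose_mul_mul_same (U : Mat m)).submatrix e) ?_
    refine PosDef.diagonal fun j => ?_
    exact_mod_cast neg_pos.2 j.2
  have hrank := rank_of_isUnit _ hpd.isUnit
  calc (Finset.univ.filter fun j => hRT.eigenvalues j < 0).card
      = Fintype.card {j // hRT.eigenvalues j < 0} := (Fintype.card_subtype _).symm
    _ = _ := hrank.symm
    _ ≤ (star (U : Mat m) * T * (U : Mat m)).rank := rank_submatrix_le _ _ _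
    _ ≤ (star (U : Mat m) * T).rank := rank_mul_le_left _ _
    _ ≤ T.rank := rank_mul_le_right _ _

lemma sum_abs_le_of_sum_eq_zero {ι : Type*} [Fintype ι] (f : ι → ℝ) (hf : ∑ i, f i = 0) {c : ℝ}
    (hc : ∀ i, |f i| ≤ c) :
    ∑ i, |f i| ≤ 2 * ((Finset.univ.filter fun j => f j < 0).card * c) := by
  have h : ∑ i, |f i| = 2 * ∑ i ∈ Finset.univ.filter (fun j => f j < 0), |f i| := by
    rw [Finset.sum_filter, Finset.mul_sum, ← sub_eq_zero, ← Finset.sum_sub_distrib]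
    refine (Finset.sum_congr rfl fun i _ => ?_).trans hf
    split_ifs with hi
    · rw [abs_of_neg hi]; ring
    · rw [abs_of_nonneg (not_lt.1 hi)]; ring
  rw [h, ← nsmul_eq_mul]
  gcongr
  exact Finset.sum_le_card_nsmul _ _ _ fun i _ => hc i

lemma hsInner_eq_sum (A B : Mat m) :
    hsInner A B = ∑ i, ∑ j, (A i j * star (B i j)).re := by
  simp [hsInner, trace, Matrix.mul_apply]

lemma frob_sq (A : Mat m) : frob A ^ 2 = ∑ i, ∑ j, ‖A i j‖ ^ 2 :=
  Real.sq_sqrt (by positivity)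

lemma frob_sub_smul_sq (A B : Mat m) (s : ℝ) :
    frob (A - s • B) ^ 2 = frob A ^ 2 - 2 * s * hsInner A B + s ^ 2 * frob B ^ 2 := by
  simp only [frob_sq, hsInner_eq_sum, Finset.mul_sum, ← Finset.sum_sub_distrib,
    ← Finset.sum_add_distrib]
  refine Finset.sum_congr rfl fun i _ => Finset.sum_congr rfl fun j _ => ?_
  simp only [← Complex.normSq_eq_norm_sq, Complex.normSq_apply]
  simp
  ring

lemma hsInner_sub_right (A B C : Mat m) : hsInner A (B - C) = hsInner A B - hsInner A C := by
  simp [hsInner, mul_sub]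

lemma hsInner_smul_right (A B : Mat m) (c : ℝ) : hsInner A (c • B) = c * hsInner A B := by
  simp [hsInner]

lemma hsInner_eq_sum_eigenvalues {A B : Mat m} (hA : A.IsHermitian) (hB : B.IsHermitian) :
    hsInner A B = ∑ i, hA.eigenvalues i * diagIn hA.eigenvectorUnitary B i := by
  rw [hsInner, hB.eq]
  conv_lhs => rw [eq_eigenvectorUnitary_mul_mul hA]
  rw [mul_assoc, mul_assoc, trace_mul_comm, mul_assoc]
  simp [trace, diagIn, diagonal_mul]

lemma hsInner_sub_nonpos_of_isProjOn {C : Set (Mat m)} (hC : Convex ℝ C) {Z P Q : Mat m}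
    (hP : IsProjOn C Z P) (hQ : Q ∈ C) : hsInner (Z - P) (Q - P) ≤ 0 := by
  by_contra! hpos
  set a := hsInner (Z - P) (Q - P)
  set b := frob (Q - P) ^ 2
  have hb : 0 ≤ b := sq_nonneg _
  have key : ∀ s : ℝ, 0 ≤ s → s ≤ 1 → 2 * s * a ≤ s ^ 2 * b := by
    intro s h0 h1
    have h := hP.2 _ (hC.add_smul_sub_mem hP.1 hQ ⟨h0, h1⟩)
    have h2 : frob (Z - P) ^ 2 ≤ frob (Z - P - s • (Q - P)) ^ 2 := by
      rw [sub_sub]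
      exact pow_le_pow_left₀ (Real.sqrt_nonneg _) h 2
    rw [frob_sub_smul_sq] at h2
    linarith
  have h1 : 0 < a + b := by linarith
  have h := key (a / (a + b)) (by positivity) ((div_le_one h1).2 (by linarith))
  have h2 : a / (a + b) * b ≤ a := by
    rw [div_mul_eq_mul_div, div_le_iff₀ h1]; nlinarith
  have h3 : 0 < a / (a + b) := by positivity
  nlinarith

lemma convex_densities : Convex ℝ (Densities m) := by
  intro A hA B hB a b ha hb hab
  refine ⟨(hA.1.smul ha).add (hB.1.smul hb), ?_⟩
  rw [trace_add, trace_smul, trace_smul, hA.2, hB.2, ← add_smul, hab, one_smul]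

lemma convex_densitiesReg (δ : ℝ) : Convex ℝ (DensitiesReg m δ) := by
  rintro _ ⟨A, hA, rfl⟩ _ ⟨B, hB, rfl⟩ a b ha hb hab
  refine ⟨a • A + b • B, convex_densities hA hB ha hb hab, ?_⟩
  have : b = 1 - a := by linarith
  subst this
  module

/-- The rank-one density matrix onto the `k`-th column of `U`. -/
lemma exists_density_diagIn (U : unitaryGroup (Fin m) ℂ) (k : Fin m) :
    ∃ σ : Mat m, IsDensity σ ∧ ∀ i, diagIn U σ i = if i = k then 1 else 0 := by
  have hpsd : (diagonal (Pi.single k 1 : Fin m → ℂ)).PosSemidef :=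
    PosSemidef.diagonal (Pi.single_nonneg.2 zero_le_one)
  refine ⟨(U : Mat m) * diagonal (Pi.single k 1) * star (U : Mat m),
    ⟨hpsd.mul_mul_conjTranspose_same _, ?_⟩, fun i => ?_⟩
  · rw [trace_mul_cycle]
    simp [trace_diagonal]
  · have h : star (U : Mat m) * ((U : Mat m) * diagonal (Pi.single k 1) * star (U : Mat m)) *
        (U : Mat m) = diagonal (Pi.single k 1) := by
      simp only [mul_assoc, Unitary.coe_star_mul_self, mul_one]
      rw [← mul_assoc, Unitary.coe_star_mul_self, one_mul]
    rw [diagIn, h]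
    by_cases hik : i = k <;> simp [hik]

lemma abs_le_of_forall_le_sum_mul {g a s e : Fin m → ℝ} {κ c : ℝ} (hκ : 0 ≤ κ)
    (ha : ∀ i, 0 ≤ a i) (hs : ∀ i, 0 ≤ s i) (ha1 : ∑ i, a i = 1) (hs1 : ∑ i, s i = 1)
    (he : ∀ i, e i = g i + κ * (a i - s i)) (hc : ∀ i, |e i| ≤ c)
    (hg : ∀ k, g k ≤ ∑ i, g i * a i) (i : Fin m) : |g i| ≤ c := by
  set t := ∑ i, g i * a i with ht
  have hsum : ∑ i, κ * (a i - s i) = 0 := by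
    rw [← Finset.mul_sum, Finset.sum_sub_distrib, ha1, hs1, sub_self, mul_zero]
  have hcompl : ∀ j, a j ≠ 0 → g j = t := by
    have h0 : ∑ j, (t - g j) * a j = 0 := by
      simp only [sub_mul, Finset.sum_sub_distrib, ← Finset.mul_sum, ha1, ← ht]
      ring
    intro j hj
    have := (Finset.sum_eq_zero_iff_of_nonneg
      fun j _ => mul_nonneg (sub_nonneg.2 (hg j)) (ha j)).1 h0 j (Finset.mem_univ j)
    rcases mul_eq_zero.1 this with h | h
    · linarith
    · exact absurd h hj
  have ht_le : t ≤ c := by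
    by_contra! hlt
    obtain ⟨j, -, hj⟩ := Finset.exists_ne_zero_of_sum_ne_zero
      (ha1 ▸ one_ne_zero : ∑ i, a i ≠ 0)
    have hneg : ∀ k, a k ≠ 0 → κ * (a k - s k) < 0 := fun k hk => by
      have := (abs_le.1 (hc k)).2
      rw [he, hcompl k hk] at this
      linarith
    refine absurd hsum (ne_of_lt (Finset.sum_neg' (fun k _ => ?_) ⟨j, Finset.mem_univ j, hneg j hj⟩))
    by_cases hk : a k = 0
    · rw [hk, zero_sub, mul_neg]
      exact neg_nonpos.2 (mul_nonneg hκ (hs k))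
    · exact (hneg k hk).le
  have hle_t : -c ≤ t := by
    by_contra! hlt
    refine absurd hsum (ne_of_gt (Finset.sum_pos (fun k _ => ?_) ⟨i, Finset.mem_univ i⟩))
    have := (abs_le.1 (hc k)).1
    rw [he] at this
    linarith [hg k]
  refine abs_le.2 ⟨?_, (hg i).trans ht_le⟩
  by_cases hi : a i = 0
  · have := (abs_le.1 (hc i)).1
    rw [he, hi] at this
    nlinarith [mul_nonneg hκ (hs i)]
  · rwa [hcompl i hi]

lemma IsDensity.sum_diagIn {S : Mat m} (hS : IsDensity S) (U : unitaryGroup (Fin m) ℂ) :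
    ∑ i, diagIn U S i = 1 := by
  rw [QST.sum_diagIn, hS.2, Complex.one_re]

lemma isHermitian_reg {S : Mat m} (hS : IsDensity S) (δ : ℝ) :
    ((1 - δ) • S + (δ / m) • (1 : Mat m)).IsHermitian :=
  (hS.1.1.smul (IsSelfAdjoint.all _)).add (isHermitian_one.smul (IsSelfAdjoint.all _))

lemma abs_diagIn_sub_proj_le {δ : ℝ} (hδ : δ < 1) {Z S ρ : Mat m} (hZ : Z.IsHermitian)
    (hS : IsDensity S) (hρ : IsDensity ρ)
    (hP : IsProjOn (DensitiesReg m δ) Z ((1 - δ) • ρ + (δ / m) • (1 : Mat m))) {c : ℝ}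
    (hc : ∀ U i, |diagIn U (Z - ((1 - δ) • S + (δ / m) • (1 : Mat m))) i| ≤ c)
    (U : unitaryGroup (Fin m) ℂ) (i : Fin m) :
    |diagIn U (Z - ((1 - δ) • ρ + (δ / m) • (1 : Mat m))) i| ≤ c := by
  have hG : (Z - ((1 - δ) • ρ + (δ / m) • (1 : Mat m))).IsHermitian :=
    hZ.sub (isHermitian_reg hρ δ)
  refine abs_diagIn_le_of_eigenvalues hG (fun j => ?_) U i
  set V := hG.eigenvectorUnitary
  refine abs_le_of_forall_le_sum_mul (a := diagIn V ρ) (s := diagIn V S) (sub_nonneg.2 hδ.le)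
    (diagIn_nonneg V hρ.1) (diagIn_nonneg V hS.1) (hρ.sum_diagIn V) (hS.sum_diagIn V)
    (fun k => ?_) (hc V) (fun k => ?_) j
  · rw [← diagIn_eigenvectorUnitary hG]
    simp only [diagIn_sub, diagIn_add, diagIn_smul, V]
    ring
  · obtain ⟨σ, hσ, hσd⟩ := exists_density_diagIn V k
    have h := hsInner_sub_nonpos_of_isProjOn (convex_densitiesReg δ) hP ⟨σ, hσ, rfl⟩
    rw [add_sub_add_right_eq_sub, ← smul_sub, hsInner_smul_right, hsInner_sub_right] at h
    have h2 := nonpos_of_mul_nonpos_right h (sub_pos.2 hδ)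
    rw [hsInner_eq_sum_eigenvalues hG hσ.1.1, hsInner_eq_sum_eigenvalues hG hρ.1.1] at h2
    simp only [V] at hσd
    simp only [hσd, mul_ite, mul_one, mul_zero, Finset.sum_ite_eq', Finset.mem_univ,
      if_true] at h2
    linarith

lemma rpow_sum_abs_rpow_le {p : ℝ} (hp : 1 ≤ p) {f : Fin m → ℝ} {M T : ℝ} (hM : 0 ≤ M)
    (hfM : ∀ i, |f i| ≤ M) (hfT : ∑ i, |f i| ≤ T) :
    (∑ i, |f i| ^ p) ^ (1 / p) ≤ T ^ (1 / p) * M ^ (1 - 1 / p) := by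
  have hp0 : 0 < p := by linarith
  have hT : 0 ≤ T := (Finset.sum_nonneg fun _ _ => abs_nonneg _).trans hfT
  have h : ∑ i, |f i| ^ p ≤ T * M ^ (p - 1) := by
    calc ∑ i, |f i| ^ p ≤ ∑ i, |f i| * M ^ (p - 1) := by
          refine Finset.sum_le_sum fun i _ => ?_
          calc |f i| ^ p = |f i| ^ (1 + (p - 1)) := by rw [add_sub_cancel]
            _ = |f i| * |f i| ^ (p - 1) := by
              rw [Real.rpow_add_of_nonneg (abs_nonneg _) zero_le_one (by linarith), Real.rpow_one]
            _ ≤ _ := by gcongr; exact hfM i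
      _ ≤ T * M ^ (p - 1) := by
          rw [← Finset.sum_mul]
          gcongr
  calc _ ≤ (T * M ^ (p - 1)) ^ (1 / p) := by gcongr
    _ = _ := by
      rw [Real.mul_rpow hT (by positivity), ← Real.rpow_mul hM]
      congr 2
      field_simp

lemma rpow_sum_abs_add_rpow_le {p : ℝ} (hp : 1 ≤ p) {d w : Fin m → ℝ} {M T R : ℝ} (hM : 0 ≤ M)
    (hdM : ∀ i, |d i| ≤ M) (hdT : ∑ i, |d i| ≤ T) (hw : ∑ i, |w i| ≤ R) :
    (∑ i, |d i + w i| ^ p) ^ (1 / p) ≤ T ^ (1 / p) * M ^ (1 - 1 / p) + R := by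
  have hR : 0 ≤ R := (Finset.sum_nonneg fun _ _ => abs_nonneg _).trans hw
  have hp1 : 1 / p ≤ 1 := (div_le_one (by linarith)).2 hp
  have hp0 : 0 ≤ 1 / p := by positivity
  refine (Real.Lp_add_le _ d w hp).trans
    (add_le_add (rpow_sum_abs_rpow_le hp hM hdM hdT) ?_)
  refine (rpow_sum_abs_rpow_le hp hR (fun i => ?_) hw).trans_eq ?_
  · exact (Finset.single_le_sum (fun j _ => abs_nonneg (w j)) (Finset.mem_univ i)).trans hw
  · rw [← Real.rpow_add_of_nonneg hR hp0 (by linarith), add_sub_cancel, Real.rpow_one]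

lemma le_min_rpow {k r a δ X : ℝ} (hk0 : 0 ≤ k) (hk1 : k ≤ 1) (hr : 0 ≤ r) (ha : 0 ≤ a)
    (hδ : 0 ≤ 1 - δ) (h1 : X ≤ (4 * r * a) ^ k * (2 * a) ^ (1 - k) + 2 * δ)
    (h2 : X ≤ (2 * (1 - δ)) ^ k * (2 * a) ^ (1 - k) + 2 * δ) :
    X ≤ min (2 ^ (3 * k + 1) * r ^ k * a) (2 * (1 - δ) ^ k * a ^ (1 - k)) + 2 * δ := by
  have two : (2 : ℝ) ^ k * 2 ^ (1 - k) = 2 := by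
    rw [← Real.rpow_add two_pos, add_sub_cancel, Real.rpow_one]
  have haa : a ^ k * a ^ (1 - k) = a := by
    rw [← Real.rpow_add_of_nonneg ha hk0 (by linarith), add_sub_cancel, Real.rpow_one]
  rw [← min_add_add_right, le_min_iff]
  constructor
  · refine h1.trans (add_le_add_left ?_ _)
    have h4 : (4 : ℝ) ^ k = 2 ^ k * 2 ^ k := by
      rw [← Real.mul_rpow two_pos.le two_pos.le]; norm_num
    rw [Real.mul_rpow (by positivity) ha, Real.mul_rpow (by norm_num) hr,
      Real.mul_rpow two_pos.le ha, h4]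
    calc _ = 2 ^ k * (2 ^ k * 2 ^ (1 - k)) * r ^ k * (a ^ k * a ^ (1 - k)) := by ring
      _ = 2 ^ (k + 1) * r ^ k * a := by rw [two, haa, Real.rpow_add two_pos, Real.rpow_one]
      _ ≤ _ := by
        gcongr
        · norm_num
        · linarith
  · refine h2.trans_eq ?_
    rw [Real.mul_rpow two_pos.le hδ, Real.mul_rpow two_pos.le ha]
    calc _ = (2 ^ k * 2 ^ (1 - k)) * (1 - δ) ^ k * a ^ (1 - k) + 2 * δ := by ring
      _ = _ := by rw [two]

/-- Schatten `p`-norm bound for the projection of `Z` onto the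
regularized set `𝒮_{m,δ}`, in terms of the operator norm distance from `Z` to a
density matrix `S` of rank at most `r`. -/
theorem stmt3 {m r : ℕ} (δ : ℝ) (hδ0 : 0 ≤ δ) (hδ1 : δ < 1)
    (p : ℝ≥0∞) (hp : 1 ≤ p)
    (Z : Mat m) (hZ : Z.IsHermitian)
    (S : Mat m) (hS : IsDensity S) (hrank : S.rank ≤ r)
    (P : Mat m) (hP : IsProjOn (DensitiesReg m δ) Z P) :
    schatten p (P - S) ≤
      min ((2 : ℝ) ^ (3 * (1 / p).toReal + 1) * (r : ℝ) ^ (1 / p).toReal *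
            (opNorm (Z - S) + 2 * δ))
          (2 * (1 - δ) ^ ((1 / p).toReal) * (opNorm (Z - S) + 2 * δ) ^ (1 - (1 / p).toReal))
        + 2 * δ := by
  obtain ⟨ρ, hρ, rfl⟩ := hP.1
  have hm : 0 < m := by
    rcases Nat.eq_zero_or_pos m with rfl | h
    · simpa [trace] using hS.2
    · exact h
  have hm1 : (1 : ℝ) ≤ m := by exact_mod_cast hm
  set a := opNorm (Z - S) + 2 * δ with ha_def
  have ha : 0 ≤ a := add_nonneg (opNorm_nonneg _) (by linarith)
  have hκ : 0 ≤ 1 - δ := by linarith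
  have hS_le : ∀ (U : unitaryGroup (Fin m) ℂ) i, diagIn U S i ≤ 1 := fun U i =>
    hS.sum_diagIn U ▸ Finset.single_le_sum (fun j _ => diagIn_nonneg U hS.1 j) (Finset.mem_univ i)
  have hinv0 : (0 : ℝ) ≤ 1 / m := by positivity
  have hinv1 : (1 : ℝ) / m ≤ 1 := (div_le_one (by linarith)).2 hm1
  have hw_le : ∀ (U : unitaryGroup (Fin m) ℂ) i, |δ * (1 / m - diagIn U S i)| ≤ δ := by
    intro U i
    rw [abs_mul, abs_of_nonneg hδ0]
    refine mul_le_of_le_one_right hδ0 (abs_le.2 ⟨?_, ?_⟩) <;>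
      linarith [hS_le U i, diagIn_nonneg U hS.1 i]
  have hE : ∀ (U : unitaryGroup (Fin m) ℂ) i,
      |diagIn U (Z - ((1 - δ) • S + (δ / m) • (1 : Mat m))) i| ≤ a := by
    intro U i
    have h1 := abs_diagIn_le_opNorm (hZ.sub hS.1.1) U i
    have h2 := hw_le U i
    have h3 : diagIn U (Z - ((1 - δ) • S + (δ / m) • (1 : Mat m))) i =
        diagIn U (Z - S) i - δ * (1 / m - diagIn U S i) := by
      simp only [diagIn_sub, diagIn_add, diagIn_smul, diagIn_one]
      ring
    rw [h3]
    refine (abs_sub _ _).trans ?_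
    linarith
  have hG := abs_diagIn_sub_proj_le hδ1 hZ hS hρ hP hE
  have hDH : ((1 - δ) • ρ - (1 - δ) • S).IsHermitian :=
    (hρ.1.smul hκ).1.sub (hS.1.smul hκ).1
  have hD : ∀ (U : unitaryGroup (Fin m) ℂ) i,
      |diagIn U ((1 - δ) • ρ - (1 - δ) • S) i| ≤ 2 * a := by
    intro U i
    have h3 : diagIn U ((1 - δ) • ρ - (1 - δ) • S) i =
        diagIn U (Z - ((1 - δ) • S + (δ / m) • (1 : Mat m))) i -
          diagIn U (Z - ((1 - δ) • ρ + (δ / m) • (1 : Mat m))) i := by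
      simp only [diagIn_sub, diagIn_add]
      ring
    rw [h3]
    refine (abs_sub _ _).trans ?_
    linarith [hE U i, hG U i]
  have hPS : ((1 - δ) • ρ + (δ / m) • (1 : Mat m) - S).IsHermitian :=
    (isHermitian_reg hρ δ).sub hS.1.1
  set V := hPS.eigenvectorUnitary with hV
  set d := diagIn V ((1 - δ) • ρ - (1 - δ) • S) with hd
  set w : Fin m → ℝ := fun i => δ * (1 / m - diagIn V S i) with hw
  have heigs : ∀ i, eigs ((1 - δ) • ρ + (δ / m) • (1 : Mat m) - S) i = d i + w i := by
    intro i
    rw [eigs, dif_pos hPS, ← diagIn_eigenvectorUnitary hPS]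
    simp only [hd, hw, ← hV, diagIn_sub, diagIn_add, diagIn_smul, diagIn_one]
    ring
  have hd_trace : ∑ i, |d i| ≤ 2 * (1 - δ) := by
    calc ∑ i, |d i| ≤ ∑ i, (1 - δ) * (diagIn V ρ i + diagIn V S i) := by
          refine Finset.sum_le_sum fun i _ => ?_
          have h1 := diagIn_nonneg V hρ.1 i
          have h2 := diagIn_nonneg V hS.1 i
          simp only [hd, diagIn_sub, diagIn_smul, ← mul_sub]
          rw [abs_mul, abs_of_nonneg hκ]
          exact mul_le_mul_of_nonneg_left (abs_le.2 ⟨by linarith, by linarith⟩) hκ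
      _ = _ := by
          rw [← Finset.mul_sum, Finset.sum_add_distrib, hρ.sum_diagIn, hS.sum_diagIn]
          ring
  have hw_trace : ∑ i, |w i| ≤ 2 * δ := by
    calc ∑ i, |w i| ≤ ∑ i, δ * (1 / m + diagIn V S i) := by
          refine Finset.sum_le_sum fun i _ => ?_
          have h2 := diagIn_nonneg V hS.1 i
          simp only [hw]
          rw [abs_mul, abs_of_nonneg hδ0]
          exact mul_le_mul_of_nonneg_left (abs_le.2 ⟨by linarith, by linarith⟩) hδ0
      _ = _ := by
          rw [← Finset.mul_sum, Finset.sum_add_distrib, hS.sum_diagIn]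
          have : (m : ℝ) ≠ 0 := by positivity
          simp only [Finset.sum_const, Finset.card_univ, Fintype.card_fin, nsmul_eq_mul]
          field_simp
          ring
  have hd_rank : ∑ i, |d i| ≤ 4 * r * a := by
    have hev : ∀ j, hDH.eigenvalues j = diagIn hDH.eigenvectorUnitary _ j := fun j =>
      (diagIn_eigenvectorUnitary hDH j).symm
    have h0 : ∑ j, hDH.eigenvalues j = 0 := by
      simp only [hev, diagIn_sub, diagIn_smul, ← mul_sub]
      rw [← Finset.mul_sum, Finset.sum_sub_distrib, hρ.sum_diagIn, hS.sum_diagIn]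
      ring
    have hcard : ((Finset.univ.filter fun j => hDH.eigenvalues j < 0).card : ℝ) ≤ r := by
      refine Nat.cast_le.2 ((card_neg_eigenvalues_le_rank (hρ.1.smul hκ) hDH).trans ?_)
      have h : (1 - δ) • S = ((1 - δ) • (1 : Mat m)) * S := by simp
      rw [h]
      exact (rank_mul_le_right _ _).trans hrank
    calc ∑ i, |d i| ≤ ∑ j, |hDH.eigenvalues j| := sum_abs_diagIn_le hDH V
      _ ≤ 2 * ((Finset.univ.filter fun j => hDH.eigenvalues j < 0).card * (2 * a)) :=
          sum_abs_le_of_sum_eq_zero _ h0 fun j => by rw [hev]; exact hD _ j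
      _ ≤ 2 * (r * (2 * a)) := by gcongr
      _ = _ := by ring
  rw [schatten]
  split_ifs with hptop
  · have : Nonempty (Fin m) := ⟨⟨0, hm⟩⟩
    have hop : opNorm ((1 - δ) • ρ + (δ / m) • (1 : Mat m) - S) ≤ 2 * a + 2 * δ := by
      refine ciSup_le fun i => ?_
      rw [heigs]
      refine (abs_add_le _ _).trans ?_
      linarith [hD V i, hw_le V i]
    simpa [hptop] using hop
  · have hp1 : 1 ≤ p.toReal := by
      simpa using ENNReal.toReal_mono hptop hp
    have hk : (1 / p).toReal = 1 / p.toReal := by simp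
    simp only [heigs, hk]
    exact le_min_rpow (by positivity) ((div_le_one (by linarith)).2 hp1) r.cast_nonneg ha hκ
      (rpow_sum_abs_add_rpow_le hp1 (by linarith) (hD V) hd_rank hw_trace)
      (rpow_sum_abs_add_rpow_le hp1 (by linarith) (hD V) hd_trace hw_trace)

end QST
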